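/- For each m ∈ {0, 1, 2}, the assignment α ↦ σ₁, ᾱ ↦ σ₁, γ ↦ σ₁, γ̄ ↦ σ₁, β ↦ σ₂ (for m = 0, α, γ ↦ σ₁ and β ↦ σ₂) induces a group isomorphism G_m/⟪αγ⁻¹⟫ ≅ B₃/⟪(σ₁σ₂σ₁)²⟫, which is isomorphic to the free product (ℤ/2) * (ℤ/3). Here ⟪·⟫ denotes the normal closure. -/

import Mathlib

namespace Sextics

/-! Generators of the free group on five letters: `0 ↦ α`, `1 ↦ ᾱ`, `2 ↦ β`, `3 ↦ γ`,
`4 ↦ γ̄`. -/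

abbrev F5 := FreeGroup (Fin 5)

def fa : F5 := FreeGroup.of 0
def fa' : F5 := FreeGroup.of 1
def fb : F5 := FreeGroup.of 2
def fc : F5 := FreeGroup.of 3
def fc' : F5 := FreeGroup.of 4

/-- Relators of the group `G̃`: the braid relations `αβα = βαβ`, `ᾱβᾱ = βᾱβ`,
`γβγ = βγβ`, `γ̄βγ̄ = βγ̄β` and the relation at infinity `βγαβγ̄ᾱ = 1`. -/
def relsT : Set F5 :=
  {fa * fb * fa * (fb * fa * fb)⁻¹, fa' * fb * fa' * (fb * fa' * fb)⁻¹,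
   fc * fb * fc * (fb * fc * fb)⁻¹, fc' * fb * fc' * (fb * fc' * fb)⁻¹,
   fb * fc * fa * fb * fc' * fa'}

/-- Relators of `G₁`: those of `G̃` together with `αγα = γαγ`, `ᾱγ̄ᾱ = γ̄ᾱγ̄`,
`γαγ̄ = γ̄ᾱγ`, `γγ̄ = γ̄γ`. -/
def rels1 : Set F5 :=
  relsT ∪
    {fa * fc * fa * (fc * fa * fc)⁻¹, fa' * fc' * fa' * (fc' * fa' * fc')⁻¹,
     fc * fa * fc' * (fc' * fa' * fc)⁻¹, fc * fc' * (fc' * fc)⁻¹}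

/-- Relators of `G₂`: those of `G̃` together with `ᾱγα = αγ̄ᾱ`, `αγ̄ᾱ = γαγ̄`,
`γαγ̄ = γ̄ᾱγ`. -/
def rels2 : Set F5 :=
  relsT ∪
    {fa' * fc * fa * (fa * fc' * fa')⁻¹, fa * fc' * fa' * (fc * fa * fc')⁻¹,
     fc * fa * fc' * (fc' * fa' * fc)⁻¹}

abbrev G1 := PresentedGroup rels1
abbrev G2 := PresentedGroup rels2

def a1 : G1 := PresentedGroup.of 0
def a1' : G1 := PresentedGroup.of 1
def b1 : G1 := PresentedGroup.of 2
def c1 : G1 := PresentedGroup.of 3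
def c1' : G1 := PresentedGroup.of 4

def a2 : G2 := PresentedGroup.of 0
def a2' : G2 := PresentedGroup.of 1
def b2 : G2 := PresentedGroup.of 2
def c2 : G2 := PresentedGroup.of 3
def c2' : G2 := PresentedGroup.of 4

/-- Relators of `G₀ = ⟨α, β, γ | αβα = βαβ, βγβ = γβγ, γαγ = αγα, (αβγ)² = 1⟩`
(generators `0 ↦ α`, `1 ↦ β`, `2 ↦ γ`). -/
def rels0 : Set (FreeGroup (Fin 3)) :=
  {FreeGroup.of 0 * FreeGroup.of 1 * FreeGroup.of 0 *
      (FreeGroup.of 1 * FreeGroup.of 0 * FreeGroup.of 1)⁻¹,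
   FreeGroup.of 1 * FreeGroup.of 2 * FreeGroup.of 1 *
      (FreeGroup.of 2 * FreeGroup.of 1 * FreeGroup.of 2)⁻¹,
   FreeGroup.of 2 * FreeGroup.of 0 * FreeGroup.of 2 *
      (FreeGroup.of 0 * FreeGroup.of 2 * FreeGroup.of 0)⁻¹,
   (FreeGroup.of 0 * FreeGroup.of 1 * FreeGroup.of 2) ^ 2}

abbrev G0 := PresentedGroup rels0

def a0 : G0 := PresentedGroup.of 0
def b0 : G0 := PresentedGroup.of 1
def c0 : G0 := PresentedGroup.of 2

/-- The braid group `B₃ = ⟨σ₁, σ₂ | σ₁σ₂σ₁ = σ₂σ₁σ₂⟩`. -/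
def relsB3 : Set (FreeGroup (Fin 2)) :=
  {FreeGroup.of 0 * FreeGroup.of 1 * FreeGroup.of 0 *
      (FreeGroup.of 1 * FreeGroup.of 0 * FreeGroup.of 1)⁻¹}

abbrev B3 := PresentedGroup relsB3

def σ1 : B3 := PresentedGroup.of 0
def σ2 : B3 := PresentedGroup.of 1

/-- The quotient `B₃/⟪(σ₁σ₂σ₁)²⟫`. -/
abbrev Q3 := B3 ⧸ Subgroup.normalClosure ({(σ1 * σ2 * σ1) ^ 2} : Set B3)

def q1 : Q3 := QuotientGroup.mk σ1
def q2 : Q3 := QuotientGroup.mk σ2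

end Sextics

open Sextics

namespace Sextics

/-! ### Universal property of `B₃/⟪(σ₁σ₂σ₁)²⟫` -/

theorem q_braid : q1 * q2 * q1 = q2 * q1 * q2 := by
  have h : σ1 * σ2 * σ1 * (σ2 * σ1 * σ2)⁻¹ = 1 :=
    PresentedGroup.one_of_mem (rels := relsB3) (Set.mem_singleton _)
  exact congrArg (QuotientGroup.mk (s := Subgroup.normalClosure {(σ1 * σ2 * σ1) ^ 2}))
    (mul_inv_eq_one.mp h)

theorem q_sq : (q1 * q2 * q1) ^ 2 = 1 :=
  (QuotientGroup.eq_one_iff _).mpr (Subgroup.subset_normalClosure (Set.mem_singleton _))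

theorem relsB3_lift {H : Type*} [Group H] {x y : H} (hb : x * y * x = y * x * y) :
    ∀ r ∈ relsB3, FreeGroup.lift ![x, y] r = 1 := by
  rintro r rfl
  simp [hb]

/-- The homomorphism from `B₃/⟪(σ₁σ₂σ₁)²⟫` determined by the images `x`, `y` of `σ₁`, `σ₂`. -/
def liftQ3 {H : Type*} [Group H] (x y : H) (hb : x * y * x = y * x * y)
    (hs : (x * y * x) ^ 2 = 1) : Q3 →* H :=
  QuotientGroup.lift _
    (PresentedGroup.toGroup (relsB3_lift hb))
    (Subgroup.normalClosure_le_normal (by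
      rintro r rfl
      simpa [MonoidHom.mem_ker, σ1, σ2] using hs))

section

variable {H : Type*} [Group H]

theorem liftQ3_q1 (x y : H) (hb : x * y * x = y * x * y) (hs : (x * y * x) ^ 2 = 1) :
    liftQ3 x y hb hs q1 = x :=
  PresentedGroup.toGroup.of (relsB3_lift hb)

theorem liftQ3_q2 (x y : H) (hb : x * y * x = y * x * y) (hs : (x * y * x) ^ 2 = 1) :
    liftQ3 x y hb hs q2 = y :=
  PresentedGroup.toGroup.of (relsB3_lift hb)

theorem Q3_hom_ext {f g : Q3 →* H} (h1 : f q1 = g q1) (h2 : f q2 = g q2) : f = g := by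
  refine QuotientGroup.monoidHom_ext _ (PresentedGroup.ext fun k => ?_)
  fin_cases k
  · exact h1
  · exact h2

end

/-! ### Quotients of presented groups isomorphic to `B₃/⟪(σ₁σ₂σ₁)²⟫` -/

/-- If the relations together with the identification of the generators `i` and `l` are
equivalent to all generators other than `j` being equal, to the braid relation, and to
`(σ₁σ₂σ₁)² = 1`, then the quotient is `B₃/⟪(σ₁σ₂σ₁)²⟫`. -/
theorem exists_mulEquiv_Q3 {ι : Type} [DecidableEq ι] (rels : Set (FreeGroup ι)) {i j l : ι}
    (hij : i ≠ j) (hlj : l ≠ j)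
    (hrels : ∀ r ∈ rels, FreeGroup.lift (fun k => if k = j then q2 else q1) r = 1)
    (hgen : ∀ (K : Type) [Group K] (g : ι → K), (∀ r ∈ rels, FreeGroup.lift g r = 1) →
      g i = g l → g i * g j * g i = g j * g i * g j ∧ (g i * g j * g i) ^ 2 = 1 ∧
        ∀ k, k ≠ j → g k = g i) :
    ∃ e : (PresentedGroup rels ⧸ Subgroup.normalClosure
        ({PresentedGroup.of i * (PresentedGroup.of l)⁻¹} : Set (PresentedGroup rels))) ≃* Q3,
      ∀ k, e (QuotientGroup.mk (PresentedGroup.of k)) = if k = j then q2 else q1 := by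
  set N := Subgroup.normalClosure
    ({PresentedGroup.of i * (PresentedGroup.of l)⁻¹} : Set (PresentedGroup rels))
  let g : ι → PresentedGroup rels ⧸ N := fun k => QuotientGroup.mk (PresentedGroup.of k)
  have hg : FreeGroup.lift g = (QuotientGroup.mk' N).comp (PresentedGroup.mk rels) := by
    ext k
    simp [g, PresentedGroup.of]
  have hil : g i = g l := by
    refine mul_inv_eq_one.mp ((QuotientGroup.eq_one_iff _).mpr ?_)
    exact Subgroup.subset_normalClosure (Set.mem_singleton _)
  obtain ⟨hb, hs, heq⟩ := hgen _ g (fun r hr => by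
    rw [hg, MonoidHom.comp_apply, PresentedGroup.one_of_mem hr, map_one]) hil
  let F : PresentedGroup rels ⧸ N →* Q3 :=
    QuotientGroup.lift N (PresentedGroup.toGroup hrels)
      (Subgroup.normalClosure_le_normal (by
        rintro r rfl
        simp [MonoidHom.mem_ker, hij, hlj]))
  have hF : ∀ k, F (g k) = if k = j then q2 else q1 := fun k => PresentedGroup.toGroup.of hrels
  refine ⟨MonoidHom.toMulEquiv F (liftQ3 (g i) (g j) hb hs) ?_ ?_, hF⟩
  · refine QuotientGroup.monoidHom_ext _ (PresentedGroup.ext fun k => ?_)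
    change liftQ3 (g i) (g j) hb hs (F (g k)) = g k
    rw [hF]
    split_ifs with hk
    · rw [liftQ3_q2, hk]
    · rw [liftQ3_q1, heq k hk]
  · apply Q3_hom_ext
    · rw [MonoidHom.comp_apply, liftQ3_q1, hF, if_neg hij, MonoidHom.id_apply]
    · rw [MonoidHom.comp_apply, liftQ3_q2, hF, if_pos rfl, MonoidHom.id_apply]

theorem braid_sq_eq_one_iff {K : Type*} [Group K] {a b : K} :
    (a * b * a) ^ 2 = 1 ↔ b * a * a * b * a * a = 1 := by
  have h : (a * b * a) ^ 2 = a * (b * a * a * b * a * a) * a⁻¹ := by simp [sq, mul_assoc]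
  rw [h, conj_eq_one_iff]

theorem relsT_q :
    ∀ r ∈ relsT, FreeGroup.lift (fun k : Fin 5 => if k = 2 then q2 else q1) r = 1 := by
  have hb := q_braid
  have hs := braid_sq_eq_one_iff.mp q_sq
  rintro r (rfl | rfl | rfl | rfl | rfl) <;> simp [fa, fa', fb, fc, fc', hb, hs]

theorem exists_mulEquiv_G0 :
    ∃ e : (G0 ⧸ Subgroup.normalClosure ({a0 * c0⁻¹} : Set G0)) ≃* Q3,
      ∀ k : Fin 3, e (QuotientGroup.mk (PresentedGroup.of k)) = if k = 1 then q2 else q1 := by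
  refine exists_mulEquiv_Q3 rels0 (i := 0) (j := 1) (l := 2) (by decide) (by decide) ?_ ?_
  · have hb := q_braid
    have hs := q_sq
    rintro r (rfl | rfl | rfl | rfl) <;> simp [hb] <;> simp [← hb, hs]
  · intro K _ g hr hil
    simp only [rels0, Set.mem_insert_iff, Set.mem_singleton_iff, forall_eq_or_imp, forall_eq,
      map_mul, map_inv, map_pow, FreeGroup.lift_apply_of, mul_inv_eq_one] at hr
    obtain ⟨hb, -, -, hs⟩ := hr
    refine ⟨hb, by rwa [← hil] at hs, fun k hk => ?_⟩
    fin_cases k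
    · rfl
    · exact absurd rfl hk
    · exact hil.symm

theorem exists_mulEquiv_G1 :
    ∃ e : (G1 ⧸ Subgroup.normalClosure ({a1 * c1⁻¹} : Set G1)) ≃* Q3,
      ∀ k : Fin 5, e (QuotientGroup.mk (PresentedGroup.of k)) = if k = 2 then q2 else q1 := by
  refine exists_mulEquiv_Q3 rels1 (i := 0) (j := 2) (l := 3) (by decide) (by decide) ?_ ?_
  · rintro r (hr | rfl | rfl | rfl | rfl)
    · exact relsT_q r hr
    all_goals simp [fa, fa', fc, fc']
  · intro K _ g hr hil
    simp only [rels1, relsT, Set.mem_union, or_imp, forall_and, Set.mem_insert_iff,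
      Set.mem_singleton_iff, forall_eq, map_mul, map_inv, fa, fa', fb, fc, fc',
      FreeGroup.lift_apply_of, mul_inv_eq_one] at hr
    obtain ⟨⟨hb, -, -, -, hinf⟩, -, h2, h3, h4⟩ := hr
    rw [← hil] at h3 h4 hinf
    have ha' : g 1 = g 0 := by
      have h : g 4 * g 0 * g 0 = g 4 * g 1 * g 0 := by
        rw [← h3, ← h4, mul_assoc, mul_assoc, h4]
      simpa using h.symm
    have hc' : g 4 = g 0 := by
      rw [ha', mul_assoc, ← h4, ← mul_assoc] at h2
      simpa [mul_assoc] using h2.symm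
    rw [ha', hc'] at hinf
    refine ⟨hb, braid_sq_eq_one_iff.mpr hinf, fun k hk => ?_⟩
    fin_cases k
    · rfl
    · exact ha'
    · exact absurd rfl hk
    · exact hil.symm
    · exact hc'

theorem exists_mulEquiv_G2 :
    ∃ e : (G2 ⧸ Subgroup.normalClosure ({a2 * c2⁻¹} : Set G2)) ≃* Q3,
      ∀ k : Fin 5, e (QuotientGroup.mk (PresentedGroup.of k)) = if k = 2 then q2 else q1 := by
  refine exists_mulEquiv_Q3 rels2 (i := 0) (j := 2) (l := 3) (by decide) (by decide) ?_ ?_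
  · rintro r (hr | rfl | rfl | rfl)
    · exact relsT_q r hr
    all_goals simp [fa, fa', fc, fc']
  · intro K _ g hr hil
    simp only [rels2, relsT, Set.mem_union, or_imp, forall_and, Set.mem_insert_iff,
      Set.mem_singleton_iff, forall_eq, map_mul, map_inv, fa, fa', fb, fc, fc',
      FreeGroup.lift_apply_of, mul_inv_eq_one] at hr
    obtain ⟨⟨hb, -, -, -, hinf⟩, h1, h2, h3⟩ := hr
    rw [← hil] at h1 h2 h3 hinf
    have h4 : g 4 * g 1 = g 0 * g 4 := by simpa [mul_assoc] using h2
    have h5 : g 4 * g 0 = g 0 * g 4 := by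
      rw [h4, mul_assoc, mul_assoc] at h3
      exact (mul_left_cancel h3).symm
    have ha' : g 1 = g 0 := mul_left_cancel (h4.trans h5.symm)
    have hc' : g 4 = g 0 := by
      rw [ha'] at h1
      simpa using h1.symm
    rw [ha', hc'] at hinf
    refine ⟨hb, braid_sq_eq_one_iff.mpr hinf, fun k hk => ?_⟩
    fin_cases k
    · rfl
    · exact ha'
    · exact absurd rfl hk
    · exact hil.symm
    · exact hc'

/-! ### The free product `ℤ/2 ∗ ℤ/3` -/

/-- The homomorphism from `ℤ/n` sending the generator to an element `x` with `xⁿ = 1`. -/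
def zmodLift {K : Type*} [Group K] (n : ℕ) (x : K) (hx : x ^ n = 1) :
    Multiplicative (ZMod n) →* K :=
  AddMonoidHom.toMultiplicativeLeft
    (ZMod.lift n ⟨zmultiplesHom (Additive K) (Additive.ofMul x), by
      simpa [zmultiplesHom] using congrArg Additive.ofMul hx⟩)

theorem zmodLift_one {K : Type*} [Group K] (n : ℕ) (x : K) (hx : x ^ n = 1) :
    zmodLift n x hx (Multiplicative.ofAdd 1) = x := by
  have h := ZMod.lift_coe n ⟨zmultiplesHom (Additive K) (Additive.ofMul x), by
      simpa [zmultiplesHom] using congrArg Additive.ofMul hx⟩ 1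
  rw [Int.cast_one] at h
  change Additive.toMul _ = x
  exact (congrArg Additive.toMul h).trans (by simp)

theorem zmod_hom_ext {K : Type*} [Group K] {n : ℕ} {f g : Multiplicative (ZMod n) →* K}
    (h : f (Multiplicative.ofAdd 1) = g (Multiplicative.ofAdd 1)) : f = g := by
  refine MonoidHom.ext fun x => ?_
  obtain ⟨m, hm⟩ := ZMod.intCast_surjective x.toAdd
  have hx : x = Multiplicative.ofAdd (1 : ZMod n) ^ m := by
    rw [← ofAdd_zsmul, zsmul_one, hm, ofAdd_toAdd]
  rw [hx, map_zpow, map_zpow, h]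

/-- The generators `σ₁σ₂σ₁` of order `2` and `σ₁σ₂` of order `3` identify `B₃/⟪(σ₁σ₂σ₁)²⟫` with
`ℤ/2 ∗ ℤ/3`. -/
theorem nonempty_Q3_mulEquiv_coprod :
    Nonempty (Q3 ≃* Monoid.Coprod (Multiplicative (ZMod 2)) (Multiplicative (ZMod 3))) := by
  let x : Monoid.Coprod (Multiplicative (ZMod 2)) (Multiplicative (ZMod 3)) :=
    Monoid.Coprod.inl (Multiplicative.ofAdd 1)
  let y : Monoid.Coprod (Multiplicative (ZMod 2)) (Multiplicative (ZMod 3)) :=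
    Monoid.Coprod.inr (Multiplicative.ofAdd 1)
  have hx : x * x = 1 := by
    rw [← map_mul, show (Multiplicative.ofAdd (1 : ZMod 2)) * Multiplicative.ofAdd 1 = 1 from rfl,
      map_one]
  have hy : y * y * y = 1 := by
    rw [← map_mul, ← map_mul, show (Multiplicative.ofAdd (1 : ZMod 3)) * Multiplicative.ofAdd 1 *
      Multiplicative.ofAdd 1 = 1 from rfl, map_one]
  have hy' : y⁻¹ * y⁻¹ = y := by
    rw [← mul_inv_rev, inv_eq_iff_mul_eq_one, hy]
  have hl : y⁻¹ * x * (x * y⁻¹) * (y⁻¹ * x) = x := by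
    calc _ = y⁻¹ * (x * x) * (y⁻¹ * y⁻¹) * x := by group
      _ = x := by rw [hx, hy']; group
  have hr : x * y⁻¹ * (y⁻¹ * x) * (x * y⁻¹) = x := by
    calc _ = x * (y⁻¹ * y⁻¹) * (x * x) * y⁻¹ := by group
      _ = x := by rw [hx, hy']; group
  have hcube : (q1 * q2) ^ 3 = 1 := by
    calc (q1 * q2) ^ 3 = (q1 * q2 * q1) * (q2 * q1 * q2) := by simp only [pow_succ, pow_zero, one_mul, mul_assoc]
      _ = 1 := by rw [← q_braid, ← sq, q_sq]
  let F := liftQ3 (y⁻¹ * x) (x * y⁻¹) (hl.trans hr.symm) (by rw [hl, sq, hx])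
  let E : Monoid.Coprod (Multiplicative (ZMod 2)) (Multiplicative (ZMod 3)) →* Q3 :=
    Monoid.Coprod.lift (zmodLift 2 _ q_sq) (zmodLift 3 _ hcube)
  have hF1 : F q1 = y⁻¹ * x := liftQ3_q1 ..
  have hF2 : F q2 = x * y⁻¹ := liftQ3_q2 ..
  have hEx : E x = q1 * q2 * q1 := zmodLift_one 2 _ q_sq
  have hEy : E y = q1 * q2 := zmodLift_one 3 _ hcube
  refine ⟨MonoidHom.toMulEquiv F E ?_ ?_⟩
  · apply Q3_hom_ext
    · rw [MonoidHom.comp_apply, hF1, map_mul, map_inv, hEx, hEy, MonoidHom.id_apply]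
      group
    · rw [MonoidHom.comp_apply, hF2, map_mul, map_inv, hEx, hEy, q_braid, MonoidHom.id_apply]
      group
  · refine Monoid.Coprod.hom_ext (zmod_hom_ext ?_) (zmod_hom_ext ?_)
    · change F (E x) = x
      rw [hEx, map_mul, map_mul, hF1, hF2, hl]
    · change F (E y) = y
      rw [hEy, map_mul, hF1, hF2]
      calc _ = y⁻¹ * (x * x) * y⁻¹ := by group
        _ = y := by rw [hx, mul_one, hy']

end Sextics

/-- Lemma `E6` of the paper: for each `m ∈ {0,1,2}`, the assignment
`α, ᾱ, γ, γ̄ ↦ σ₁`, `β ↦ σ₂` (for `m = 0`: `α, γ ↦ σ₁`, `β ↦ σ₂`) induces an isomorphism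
`G_m/⟪αγ⁻¹⟫ ≅ B₃/⟪(σ₁σ₂σ₁)²⟫ ≅ ℤ/2 ∗ ℤ/3`. -/
theorem perturbed_E6_groups :
    (∃ e : (G0 ⧸ Subgroup.normalClosure ({a0 * c0⁻¹} : Set G0)) ≃* Q3,
        e (QuotientGroup.mk a0) = q1 ∧ e (QuotientGroup.mk c0) = q1 ∧
        e (QuotientGroup.mk b0) = q2) ∧
    (∃ e : (G1 ⧸ Subgroup.normalClosure ({a1 * c1⁻¹} : Set G1)) ≃* Q3,
        e (QuotientGroup.mk a1) = q1 ∧ e (QuotientGroup.mk a1') = q1 ∧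
        e (QuotientGroup.mk c1) = q1 ∧ e (QuotientGroup.mk c1') = q1 ∧
        e (QuotientGroup.mk b1) = q2) ∧
    (∃ e : (G2 ⧸ Subgroup.normalClosure ({a2 * c2⁻¹} : Set G2)) ≃* Q3,
        e (QuotientGroup.mk a2) = q1 ∧ e (QuotientGroup.mk a2') = q1 ∧
        e (QuotientGroup.mk c2) = q1 ∧ e (QuotientGroup.mk c2') = q1 ∧
        e (QuotientGroup.mk b2) = q2) ∧
    Nonempty (Q3 ≃* Monoid.Coprod (Multiplicative (ZMod 2)) (Multiplicative (ZMod 3))) := by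
  obtain ⟨e0, h0⟩ := exists_mulEquiv_G0
  obtain ⟨e1, h1⟩ := exists_mulEquiv_G1
  obtain ⟨e2, h2⟩ := exists_mulEquiv_G2
  exact ⟨⟨e0, h0 0, h0 2, h0 1⟩, ⟨e1, h1 0, h1 1, h1 3, h1 4, h1 2⟩,
    ⟨e2, h2 0, h2 1, h2 3, h2 4, h2 2⟩, nonempty_Q3_mulEquiv_coprod⟩
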